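/- There is no divisible design Cayley graph with parameters (24, 10, 6, 3, 3, 8); that is, no simple graph on 24 vertices that is simultaneously a divisible design graph with parameters (24, 10, 6, 3, 3, 8) and a Cayley graph. -/

import Mathlib

/-- A divisible design graph (DDG) with parameters `(v, k, l1, l2, m, n)`:
a `k`-regular simple graph on `v = m * n` vertices whose vertex set can be partitioned
into `m` classes of size `n` such that two distinct vertices from the same class have
exactly `l1` common neighbours and two vertices from different classes have exactly `l2`
common neighbours. -/
def IsDDG {V : Type*} (Γ : SimpleGraph V) (v k l1 l2 m n : ℕ) : Prop :=
  Nat.card V = v ∧ v = m * n ∧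
  (∀ x : V, Nat.card {z : V // Γ.Adj x z} = k) ∧
  ∃ c : V → Fin m,
    (∀ i : Fin m, Nat.card {x : V // c x = i} = n) ∧
    (∀ x y : V, x ≠ y → c x = c y →
      Nat.card {z : V // Γ.Adj x z ∧ Γ.Adj y z} = l1) ∧
    (∀ x y : V, c x ≠ c y →
      Nat.card {z : V // Γ.Adj x z ∧ Γ.Adj y z} = l2)

/-- A simple graph is a Cayley graph if and only if its automorphism group contains a
subgroup acting regularly (sharply transitively) on the vertices. -/
def IsCayleyGraph {V : Type*} (Γ : SimpleGraph V) : Prop :=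
  ∃ H : Subgroup (Equiv.Perm V),
    (∀ g ∈ H, ∀ x y : V, Γ.Adj (g x) (g y) ↔ Γ.Adj x y) ∧
    ∀ x y : V, ∃! g : Equiv.Perm V, g ∈ H ∧ g x = y

namespace SimpleGraph

open Finset

variable {V ι : Type*} [Fintype V] [DecidableEq ι]

/-- The number of neighbours of `x` in the class labelled `i` of the partition `c`. -/
def classDegree (Γ : SimpleGraph V) [DecidableRel Γ.Adj] (c : V → ι) (x : V) (i : ι) : ℤ :=
  ∑ z, Γ.adjMatrix ℤ x z * if c z = i then 1 else 0

/-- The indicator matrix of the relation of lying in the same class of the partition `c`. -/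
def classMatrix (c : V → ι) : Matrix V V ℤ :=
  Matrix.of fun x y => if c x = c y then 1 else 0

variable (Γ : SimpleGraph V) [DecidableRel Γ.Adj] (c : V → ι)

theorem adjMatrix_mul_classMatrix_apply (x y : V) :
    (Γ.adjMatrix ℤ * classMatrix c) x y = Γ.classDegree c x (c y) := rfl

theorem classMatrix_mul_adjMatrix_apply (x y : V) :
    (classMatrix c * Γ.adjMatrix ℤ) x y = Γ.classDegree c y (c x) := by
  simp only [Matrix.mul_apply, classDegree, classMatrix, Matrix.of_apply]
  refine sum_congr rfl fun z _ => ?_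
  simp only [mul_comm, adjMatrix_apply, Γ.adj_comm z y, eq_comm (a := c x)]

theorem sum_classDegree [Fintype ι] (x : V) :
    ∑ i, Γ.classDegree c x i = ∑ z, Γ.adjMatrix ℤ x z := by
  unfold classDegree
  rw [sum_comm]
  simp

theorem sq_adjMatrix_apply (x y : V) :
    (Γ.adjMatrix ℤ * Γ.adjMatrix ℤ) x y = Nat.card {z : V // Γ.Adj x z ∧ Γ.Adj y z} := by
  rw [Nat.card_eq_fintype_card, Fintype.card_subtype, card_filter, Matrix.mul_apply]
  push_cast
  refine sum_congr rfl fun z _ => ?_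
  simp only [adjMatrix_apply, Γ.adj_comm z y]
  by_cases h₁ : Γ.Adj x z <;> by_cases h₂ : Γ.Adj y z <;> simp [h₁, h₂]

theorem sum_adjMatrix_apply (x : V) :
    ∑ z, Γ.adjMatrix ℤ x z = Nat.card {z : V // Γ.Adj x z} := by
  rw [Nat.card_eq_fintype_card, Fintype.card_subtype, card_filter]
  simp [adjMatrix_apply]

/-- If `A²` is a combination of `1`, the class matrix and the all-ones matrix and `A` is regular,
then the partition into classes is equitable with symmetric quotient matrix. -/
theorem classDegree_symm [DecidableEq V] {k a b d : ℤ} (hb : b ≠ 0)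
    (hk : ∀ x, ∑ z, Γ.adjMatrix ℤ x z = k)
    (hA : Γ.adjMatrix ℤ * Γ.adjMatrix ℤ =
      a • (1 : Matrix V V ℤ) + b • classMatrix c + d • Matrix.of fun _ _ => 1) (x y : V) :
    Γ.classDegree c x (c y) = Γ.classDegree c y (c x) := by
  have hcomm := (mul_assoc (Γ.adjMatrix ℤ) (Γ.adjMatrix ℤ) (Γ.adjMatrix ℤ))
  rw [hA] at hcomm
  have h := congrFun (congrFun hcomm x) y
  have hr : (Γ.adjMatrix ℤ * (Matrix.of fun _ _ => 1 : Matrix V V ℤ)) x y = k := by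
    simpa [Matrix.mul_apply] using hk x
  have hl : ((Matrix.of fun _ _ => 1 : Matrix V V ℤ) * Γ.adjMatrix ℤ) x y = k := by
    rw [← hk y]
    simp [Matrix.mul_apply, Γ.adj_comm y]
  simp only [add_mul, mul_add, smul_mul_assoc, mul_smul_comm, one_mul, mul_one,
    Matrix.add_apply, Matrix.smul_apply, smul_eq_mul, hr, hl, adjMatrix_mul_classMatrix_apply,
    classMatrix_mul_adjMatrix_apply] at h
  exact mul_left_cancel₀ hb (by linarith)

theorem sum_sq_classDegree [Fintype ι]
    (hsymm : ∀ x y, Γ.classDegree c x (c y) = Γ.classDegree c y (c x)) (x : V) :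
    ∑ i, Γ.classDegree c x i ^ 2 =
      ∑ w, (Γ.adjMatrix ℤ * Γ.adjMatrix ℤ) x w * if c w = c x then 1 else 0 := by
  have h₁ : ∑ i, Γ.classDegree c x i ^ 2 =
      ∑ z, Γ.adjMatrix ℤ x z * Γ.classDegree c z (c x) := by
    simp_rw [hsymm _ x, sq]
    conv_lhs => enter [2, i, 1]; unfold classDegree
    simp_rw [sum_mul]
    rw [sum_comm]
    refine sum_congr rfl fun z _ => ?_
    simp
  rw [h₁]
  simp_rw [classDegree, mul_sum, Matrix.mul_apply, sum_mul]
  rw [sum_comm]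
  simp_rw [mul_assoc]

theorem classDegree_apply_perm (g : Equiv.Perm V) (hg : ∀ x y, Γ.Adj (g x) (g y) ↔ Γ.Adj x y)
    (hc : ∀ x y, c (g x) = c (g y) ↔ c x = c y) (x : V) :
    Γ.classDegree c (g x) (c (g x)) = Γ.classDegree c x (c x) := by
  unfold classDegree
  rw [← Equiv.sum_comp g]
  simp [adjMatrix_apply, hg, hc]

end SimpleGraph

/-- There is no divisible design Cayley graph with parameters
`(24, 10, 6, 3, 3, 8)`. -/
theorem no_ddcg_24_10_6_3_3_8 :
    ¬ ∃ (V : Type) (Γ : SimpleGraph V),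
        IsDDG Γ 24 10 6 3 3 8 ∧ IsCayleyGraph Γ := by
  classical
  rintro ⟨V, Γ, ⟨hV, -, hk, c, hn, hl₁, hl₂⟩, H, hH, hreg⟩
  have : Finite V := Nat.finite_of_card_ne_zero (by omega)
  have := Fintype.ofFinite V
  have hk' : ∀ x, ∑ z, Γ.adjMatrix ℤ x z = 10 := fun x => by
    rw [SimpleGraph.sum_adjMatrix_apply, hk, Nat.cast_ofNat]
  have hA : Γ.adjMatrix ℤ * Γ.adjMatrix ℤ =
      (4 : ℤ) • (1 : Matrix V V ℤ) + (3 : ℤ) • SimpleGraph.classMatrix c +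
        (3 : ℤ) • Matrix.of fun _ _ => 1 := by
    ext x y
    simp only [SimpleGraph.sq_adjMatrix_apply, SimpleGraph.classMatrix, Matrix.add_apply,
      Matrix.smul_apply, Matrix.of_apply, smul_eq_mul, Matrix.one_apply]
    by_cases hxy : x = y
    · subst hxy
      simp only [and_self, hk]
      norm_num
    · by_cases hc : c x = c y
      · norm_num [-Nat.card_eq_fintype_card, hl₁ x y hxy hc, hc, hxy]
      · norm_num [-Nat.card_eq_fintype_card, hl₂ x y hc, hc, hxy]
  have hsymm := Γ.classDegree_symm c (by norm_num) hk' hA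
  have hsq : ∀ x, ∑ i, Γ.classDegree c x i ^ 2 = 52 := fun x => by
    have hcard : ∑ w, (if c w = c x then (1 : ℤ) else 0) = 8 := by
      rw [← Finset.natCast_card_filter, ← Fintype.card_subtype, ← Nat.card_eq_fintype_card,
        hn, Nat.cast_ofNat]
    rw [Γ.sum_sq_classDegree c hsymm, hA]
    calc _ = ∑ w, ((if x = w then (4 : ℤ) else 0) + 6 * if c w = c x then 1 else 0) := by
          refine Finset.sum_congr rfl fun w _ => ?_
          simp only [SimpleGraph.classMatrix, Matrix.add_apply, Matrix.smul_apply,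
            Matrix.of_apply, smul_eq_mul, Matrix.one_apply, eq_comm (a := c x)]
          by_cases hw : x = w
          · simp [hw]
          · by_cases hc : c w = c x <;> simp [hw, hc]
      _ = 52 := by
          rw [Finset.sum_add_distrib, ← Finset.mul_sum, hcard]
          simp
  have hclass : ∀ g ∈ H, ∀ x y, c (g x) = c (g y) ↔ c x = c y := fun g hg x y => by
    by_cases hxy : x = y
    · simp [hxy]
    have hcn : Nat.card {z : V // Γ.Adj (g x) z ∧ Γ.Adj (g y) z} =
        Nat.card {z : V // Γ.Adj x z ∧ Γ.Adj y z} :=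
      (Nat.card_congr (g.subtypeEquiv fun z => by rw [hH g hg, hH g hg])).symm
    have hgxy : g x ≠ g y := g.injective.ne hxy
    by_cases h₁ : c (g x) = c (g y) <;> by_cases h₂ : c x = c y <;> simp only [h₁, h₂]
    · rw [hl₁ _ _ hgxy h₁, hl₂ _ _ h₂] at hcn
      omega
    · rw [hl₂ _ _ h₁, hl₁ _ _ hxy h₂] at hcn
      omega
  have hdiag : ∀ x y, Γ.classDegree c x (c x) = Γ.classDegree c y (c y) := fun x y => by
    obtain ⟨g, ⟨hg, rfl⟩, -⟩ := hreg x y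
    exact (Γ.classDegree_apply_perm c g (hH g hg) (hclass g hg) x).symm
  have hrep : ∀ i, ∃ x, c x = i := fun i => by
    have : Nonempty {x : V // c x = i} := (Nat.card_pos_iff.1 (by rw [hn]; omega)).1
    exact ⟨this.some.1, this.some.2⟩
  choose f hf using hrep
  have hsymm' : ∀ i j, Γ.classDegree c (f i) j = Γ.classDegree c (f j) i := fun i j => by
    simpa only [hf] using hsymm (f i) (f j)
  have hdiag' : ∀ i j, Γ.classDegree c (f i) i = Γ.classDegree c (f j) j := fun i j => by
    simpa only [hf] using hdiag (f i) (f j)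
  have hsum : ∀ i, ∑ j, Γ.classDegree c (f i) j = 10 := fun i => by
    rw [SimpleGraph.sum_classDegree, hk']
  have h₀ := hsum 0
  have h₁ := hsum 1
  have h₂ := hsum 2
  have hs := hsq (f 0)
  rw [Fin.sum_univ_three] at h₀ h₁ h₂ hs
  have e₁ := hdiag' 0 1
  have e₂ := hdiag' 0 2
  have e₃ := hsymm' 0 1
  have e₄ := hsymm' 0 2
  have e₅ := hsymm' 1 2
  generalize Γ.classDegree c (f 0) 1 = a at *
  have hb : Γ.classDegree c (f 0) 2 = a := by linarith
  have hd : Γ.classDegree c (f 0) 0 = 10 - 2 * a := by linarith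
  rw [hb, hd] at hs
  have ha₀ : 0 ≤ a := by nlinarith
  have ha₁ : a ≤ 7 := by nlinarith
  interval_cases a <;> omega
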